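/- Let n ≥ 2 and let G be a strongly connected directed simple graph on V = Fin n with distinguished vertex 0. Let v : Fin n and let S₁, S₂ : Set (Fin n) satisfy S₁ ∪ S₂ = Set.univ, S₁ ∩ S₂ = {v}, and 0 ∈ S₁, and suppose every edge of G joins two vertices of S₁ or two vertices of S₂ (for all a b, E a b → (a ∈ S₁ ∧ b ∈ S₁) ∨ (a ∈ S₂ ∧ b ∈ S₂)). Let G₁ and G₂ be the induced subgraphs of G on the subtypes ↥S₁ and ↥S₂, with distinguished vertices 0 (in S₁) and v (in S₂) respectively. Then: (1) if there exists A₁ ∈ Θ_{G₁} such that B_{G₁}(A₁) has full column rank and there exists A₂ ∈ Θ_{G₂} such that B_{G₂}(A₂) has full column rank, then there exists A ∈ Θ_G such that B_G(A) (with distinguished vertex 0) has full column rank; and (2) if no A₂ ∈ Θ_{G₂} has B_{G₂}(A₂) of full column rank, then no A ∈ Θ_G has B_G(A) of full column rank. -/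

import Mathlib

open Matrix

attribute [local instance] Classical.propDecidable

variable {V : Type*}

/-- The parameter space `Θ_G` of a directed simple graph given by the edge
relation `E` (where `E j i` means there is an edge `j → i`): matrices whose
off-diagonal entry `(i,j)` vanishes unless `j → i` is an edge. -/
def Theta (E : V → V → Prop) : Set (Matrix V V ℂ) :=
  {A | ∀ i j, i ≠ j → ¬ E j i → A i j = 0}

/-- The coefficient matrix `B_G(A)`: rows indexed by the non-edges
`(k,l)` (the zero positions of a generic element of `Θ_G`), columns indexed
by pairs `(i,j)` with `i ≠ j` avoiding the distinguished vertex `r`. -/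
noncomputable def Bmat (E : V → V → Prop) (r : V) (A : Matrix V V ℂ) :
    Matrix {p : V × V // p.1 ≠ p.2 ∧ ¬ E p.2 p.1}
      {p : V × V // p.1 ≠ p.2 ∧ p.1 ≠ r ∧ p.2 ≠ r} ℂ :=
  fun kl ij =>
    if ij.1.1 = kl.1.1 ∧ ij.1.2 = kl.1.2 then A kl.1.1 kl.1.1 - A kl.1.2 kl.1.2
    else if ij.1.1 = kl.1.1 then -A ij.1.2 kl.1.2
    else if ij.1.2 = kl.1.2 then A kl.1.1 ij.1.1
    else 0

/-- `B_G(A)` has full column rank `(|V|-1)(|V|-2)` for some `A ∈ Θ_G`. -/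
def HasFullB [Fintype V] (E : V → V → Prop) (r : V) : Prop :=
  ∃ A ∈ Theta E, (Bmat E r A).rank = (Fintype.card V - 1) * (Fintype.card V - 2)

/-- If `f₀` composed with the quotient by `q` is injective on `p`, then so is the quadratic
pencil `f₀ + t f₁ + t² f₂` for all but finitely many `t`. -/
theorem finite_not_injOn_pencil {M N : Type*} [AddCommGroup M] [Module ℂ M]
    [FiniteDimensional ℂ M] [AddCommGroup N] [Module ℂ N]
    (p : Submodule ℂ M) (q : Submodule ℂ N) (f₀ f₁ f₂ : M →ₗ[ℂ] N)
    (h : ∀ x ∈ p, f₀ x ∈ q → x = 0) :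
    {t : ℂ | ¬ ∀ x ∈ p, f₀ x + t • f₁ x + t ^ 2 • f₂ x ∈ q → x = 0}.Finite := by
  classical
  let φ : (M →ₗ[ℂ] N) →ₗ[ℂ] (p →ₗ[ℂ] N ⧸ q) :=
    (LinearMap.llcomp ℂ p N (N ⧸ q) q.mkQ).comp (LinearMap.lcomp ℂ N p.subtype)
  have hφ : ∀ f x, φ f x = q.mkQ (f x) := fun _ _ => rfl
  have hker : LinearMap.ker (φ f₀) = ⊥ := by
    rw [LinearMap.ker_eq_bot']
    intro x hx
    rw [hφ, Submodule.mkQ_apply, Submodule.Quotient.mk_eq_zero] at hx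
    exact Subtype.ext (h x x.2 hx)
  obtain ⟨R, hR⟩ := (φ f₀).exists_leftInverse_of_injective hker
  let b := Module.finBasis ℂ p
  let m (f : M →ₗ[ℂ] N) := LinearMap.toMatrix b b (R ∘ₗ φ f)
  have hm : m f₀ = 1 := by simp only [m, hR, LinearMap.toMatrix_id]
  let P : Polynomial ℂ := Matrix.det ((m f₀).map Polynomial.C
    + (Polynomial.X : Polynomial ℂ) • (m f₁).map Polynomial.C
    + (Polynomial.X ^ 2 : Polynomial ℂ) • (m f₂).map Polynomial.C)
  have hP : ∀ t, P.eval t = (m f₀ + t • m f₁ + t ^ 2 • m f₂).det := by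
    intro t
    rw [← Polynomial.coe_evalRingHom, RingHom.map_det]
    congr 1
    ext i j
    simp [mul_comm t, mul_comm (t ^ 2)]
  have hP0 : P ≠ 0 := by
    intro h0
    have := hP 0
    simp [h0, hm] at this
  refine (P.rootSet_finite ℂ).subset fun t ht => ?_
  rw [Polynomial.mem_rootSet]
  refine ⟨hP0, ?_⟩
  rw [Polynomial.coe_aeval_eq_eval, hP]
  by_contra hdet
  refine ht fun x hx hxq => ?_
  have h1 : φ (f₀ + t • f₁ + t ^ 2 • f₂) ⟨x, hx⟩ = 0 := by
    rw [hφ, Submodule.mkQ_apply, Submodule.Quotient.mk_eq_zero]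
    exact hxq
  have h2 : m f₀ + t • m f₁ + t ^ 2 • m f₂
      = LinearMap.toMatrix b b (R ∘ₗ φ (f₀ + t • f₁ + t ^ 2 • f₂)) := by
    simp only [m, map_add, map_smul, LinearMap.comp_add, LinearMap.comp_smul]
  rw [h2, LinearMap.det_toMatrix] at hdet
  have h3 : (⟨x, hx⟩ : p) = 0 := (LinearMap.equivOfDetNeZero _ hdet).injective
    (show R (φ _ ⟨x, hx⟩) = R (φ _ 0) by rw [h1, map_zero, map_zero, map_zero])
  exact congrArg Subtype.val h3

/-- The linear pencil case of `finite_not_injOn_pencil`. -/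
theorem finite_not_injOn_line {M N : Type*} [AddCommGroup M] [Module ℂ M]
    [FiniteDimensional ℂ M] [AddCommGroup N] [Module ℂ N]
    (p : Submodule ℂ M) (q : Submodule ℂ N) (f₀ f₁ : M →ₗ[ℂ] N)
    (h : ∀ x ∈ p, f₀ x ∈ q → x = 0) :
    {t : ℂ | ¬ ∀ x ∈ p, f₀ x + t • f₁ x ∈ q → x = 0}.Finite := by
  simpa using finite_not_injOn_pencil p q f₀ f₁ 0 h

/-- A property of vectors that, once it holds at a point of a line, holds at all but finitely
many points of the line. -/
def CofiniteOnLines {M : Type*} [AddCommGroup M] [Module ℂ M] (P : M → Prop) : Prop :=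
  ∀ A B, P A → {t : ℂ | ¬ P (A + t • B)}.Finite

theorem CofiniteOnLines.and {M : Type*} [AddCommGroup M] [Module ℂ M] {P Q : M → Prop}
    (hP : CofiniteOnLines P) (hQ : CofiniteOnLines Q) :
    CofiniteOnLines fun A => P A ∧ Q A := by
  intro A B h
  refine ((hP A B h.1).union (hQ A B h.2)).subset fun t ht => ?_
  simp only [Set.mem_ofPred_eq, Set.mem_union] at ht ⊢
  tauto

theorem CofiniteOnLines.exists_and {M : Type*} [AddCommGroup M] [Module ℂ M] {P Q : M → Prop}
    (hP : CofiniteOnLines P) (hQ : CofiniteOnLines Q) (q : Submodule ℂ M)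
    (h₁ : ∃ A ∈ q, P A) (h₂ : ∃ A ∈ q, Q A) : ∃ A ∈ q, P A ∧ Q A := by
  obtain ⟨A, hA, hPA⟩ := h₁
  obtain ⟨B, hB, hQB⟩ := h₂
  have h1 := hP A (B - A) hPA
  have h2 := (hQ B (A - B) hQB).image (fun t => 1 - t)
  obtain ⟨t, ht⟩ := (h1.union h2).infinite_compl.nonempty
  simp only [Set.mem_compl_iff, Set.mem_union, not_or] at ht
  refine ⟨A + t • (B - A), q.add_mem hA (q.smul_mem _ (q.sub_mem hB hA)), not_not.1 ht.1, ?_⟩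
  by_contra hnQ
  refine ht.2 ⟨1 - t, ?_, by ring⟩
  have e : A + t • (B - A) = B + (1 - t) • (A - B) := by module
  rwa [e] at hnQ

/-- The parameter space `Θ_G` as a submodule. -/
def thetaSubmodule (E : V → V → Prop) : Submodule ℂ (Matrix V V ℂ) where
  carrier := Theta E
  add_mem' {A B} hA hB i j h h' := by simp [hA i j h h', hB i j h h']
  zero_mem' _ _ _ _ := rfl
  smul_mem' c A hA i j h h' := by simp [hA i j h h']

theorem mem_thetaSubmodule {E : V → V → Prop} {A : Matrix V V ℂ} :
    A ∈ thetaSubmodule E ↔ A ∈ Theta E := Iff.rfl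

/-- The matrices supported on `S × S`. -/
def supportedOn (S : Set V) : Submodule ℂ (Matrix V V ℂ) where
  carrier := {A | ∀ i j, i ∉ S ∨ j ∉ S → A i j = 0}
  add_mem' {A B} hA hB i j h := by simp [hA i j h, hB i j h]
  zero_mem' _ _ _ := rfl
  smul_mem' c A hA i j h := by simp [hA i j h]

/-- The matrices supported on `S × S` with zero diagonal and zero `r`-th row and column. -/
def hollowOn (S : Set V) (r : V) : Submodule ℂ (Matrix V V ℂ) where
  carrier := {A | ∀ i j, i = j ∨ i = r ∨ j = r ∨ i ∉ S ∨ j ∉ S → A i j = 0}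
  add_mem' {A B} hA hB i j h := by simp [hA i j h, hB i j h]
  zero_mem' _ _ _ := rfl
  smul_mem' c A hA i j h := by simp [hA i j h]

/-- No nonzero matrix in `hollowOn S r` has its commutator with `A` in `Θ_G`. -/
def IsFullAt [Fintype V] (E : V → V → Prop) (S : Set V) (r : V) (A : Matrix V V ℂ) : Prop :=
  ∀ X ∈ hollowOn S r, A * X - X * A ∈ Theta E → X = 0

theorem Bmat_mulVec [Fintype V] (E : V → V → Prop) (r : V) (A X : Matrix V V ℂ)
    (hX : X ∈ hollowOn Set.univ r) (kl : {p : V × V // p.1 ≠ p.2 ∧ ¬ E p.2 p.1}) :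
    (Bmat E r A *ᵥ fun p => X p.1.1 p.1.2) kl = (A * X - X * A) kl.1.1 kl.1.2 := by
  obtain ⟨⟨k, l⟩, hkl⟩ := kl
  let F : V × V → ℂ := fun p =>
    ((if p.2 = l then A k p.1 else 0) - (if p.1 = k then A p.2 l else 0)) * X p.1 p.2
  have h1 : (Bmat E r A *ᵥ fun p => X p.1.1 p.1.2) ⟨(k, l), hkl⟩
      = ∑ p : {p : V × V // p.1 ≠ p.2 ∧ p.1 ≠ r ∧ p.2 ≠ r}, F p.1 := by
    simp only [Matrix.mulVec, dotProduct]
    refine Finset.sum_congr rfl fun p _ => ?_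
    obtain ⟨⟨i, j⟩, hp⟩ := p
    simp only [Bmat, F]
    by_cases hi : i = k <;> by_cases hj : j = l <;> simp [hi, hj]
  have h2 : ∑ p : {p : V × V // p.1 ≠ p.2 ∧ p.1 ≠ r ∧ p.2 ≠ r}, F p.1 = ∑ p, F p := by
    rw [← Finset.sum_subtype (Finset.univ.filter fun p : V × V => p.1 ≠ p.2 ∧ p.1 ≠ r ∧ p.2 ≠ r)
      (by simp) F]
    refine Finset.sum_filter_of_ne fun p _ hp => ?_
    by_contra hn
    exact hp (mul_eq_zero_of_right _ (hX p.1 p.2 (by tauto)))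
  rw [h1, h2, Fintype.sum_prod_type]
  simp only [F, sub_mul, ite_mul, zero_mul, Finset.sum_sub_distrib, Finset.sum_ite_eq',
    Finset.mem_univ, if_true, Matrix.sub_apply, Matrix.mul_apply]
  congr 1
  rw [Finset.sum_comm]
  simp [mul_comm]

theorem card_offDiag_ne [Fintype V] (r : V) :
    Fintype.card {p : V × V // p.1 ≠ p.2 ∧ p.1 ≠ r ∧ p.2 ≠ r}
      = (Fintype.card V - 1) * (Fintype.card V - 2) := by
  have e : (Finset.univ.filter fun p : V × V => p.1 ≠ p.2 ∧ p.1 ≠ r ∧ p.2 ≠ r)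
      = (Finset.univ.erase r).offDiag := by
    ext p
    simp only [Finset.mem_filter, Finset.mem_univ, true_and, Finset.mem_offDiag,
      Finset.mem_erase, and_true]
    tauto
  rw [Fintype.card_subtype, e, Finset.offDiag_card, Finset.card_erase_of_mem (Finset.mem_univ r),
    Finset.card_univ, show Fintype.card V - 2 = Fintype.card V - 1 - 1 by omega,
    Nat.mul_sub_one (Fintype.card V - 1) (Fintype.card V - 1)]

theorem Bmat_rank_eq_iff [Fintype V] (E : V → V → Prop) (r : V) (A : Matrix V V ℂ) :
    (Bmat E r A).rank = (Fintype.card V - 1) * (Fintype.card V - 2)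
      ↔ IsFullAt E Set.univ r A := by
  have h := LinearMap.finrank_range_add_finrank_ker (Bmat E r A).mulVecLin
  rw [Module.finrank_fintype_fun_eq_card, card_offDiag_ne] at h
  have h' : (Bmat E r A).rank = (Fintype.card V - 1) * (Fintype.card V - 2)
      ↔ LinearMap.ker (Bmat E r A).mulVecLin = ⊥ := by
    rw [← Submodule.finrank_eq_zero (R := ℂ), Matrix.rank]
    omega
  rw [h', Matrix.ker_mulVecLin_eq_bot_iff]
  constructor
  · intro hB X hX hC
    have h0 := hB (fun p => X p.1.1 p.1.2) <| by
      ext kl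
      rw [Bmat_mulVec E r A X hX]
      exact hC _ _ kl.2.1 kl.2.2
    ext i j
    by_cases hij : i ≠ j ∧ i ≠ r ∧ j ≠ r
    · exact congrFun h0 ⟨(i, j), hij⟩
    · exact hX i j (by tauto)
  · intro hA x hx
    let X : Matrix V V ℂ := fun i j =>
      if h : i ≠ j ∧ i ≠ r ∧ j ≠ r then x ⟨(i, j), h⟩ else 0
    have hX : X ∈ hollowOn Set.univ r := by
      intro i j hij
      refine dif_neg fun h => ?_
      simp only [Set.mem_univ, not_true, or_false] at hij
      tauto
    have hxX : x = fun p => X p.1.1 p.1.2 := by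
      ext p
      simp only [X, dif_pos p.2]
    have hX0 : X = 0 := hA X hX fun k l hkl hE => by
      have := Bmat_mulVec E r A X hX ⟨(k, l), hkl, hE⟩
      rw [← hxX, hx] at this
      exact this.symm
    rw [hxX, hX0]
    rfl

theorem hasFullB_iff [Fintype V] (E : V → V → Prop) (r : V) :
    HasFullB E r ↔ ∃ A ∈ Theta E, IsFullAt E Set.univ r A := by
  simp only [HasFullB, Bmat_rank_eq_iff]

/-- The principal submatrix on a set of vertices. -/
abbrev principal (S : Set V) (A : Matrix V V ℂ) : Matrix S S ℂ :=
  A.submatrix Subtype.val Subtype.val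

theorem principal_mul [Fintype V] {S : Set V} [Fintype S] {A X : Matrix V V ℂ}
    (hA : A ∈ supportedOn S) :
    principal S (A * X) = principal S A * principal S X := by
  ext i j
  simp only [Matrix.submatrix_apply, Matrix.mul_apply]
  rw [← Finset.sum_subtype (Finset.univ.filter fun k : V => k ∈ S) (by simp)
    fun k => A i k * X k j]
  refine (Finset.sum_filter_of_ne fun k _ hk => ?_).symm
  by_contra hkS
  exact hk (by rw [hA i k (Or.inr hkS), zero_mul])

theorem mul_mem_supportedOn [Fintype V] {S : Set V} {A B : Matrix V V ℂ}
    (hA : A ∈ supportedOn S) (hB : B ∈ supportedOn S) : A * B ∈ supportedOn S := by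
  intro i j hij
  rw [Matrix.mul_apply]
  refine Finset.sum_eq_zero fun k _ => ?_
  rcases hij with h | h
  · rw [hA i k (Or.inl h), zero_mul]
  · rw [hB k j (Or.inr h), mul_zero]

theorem hollowOn_le_supportedOn (S : Set V) (r : V) : hollowOn S r ≤ supportedOn S :=
  fun _ hX i j h => hX i j (Or.inr (Or.inr (Or.inr h)))

/-- Extension of a matrix on a subtype by zero. -/
noncomputable def extendZero (S : Set V) (A : Matrix S S ℂ) : Matrix V V ℂ := fun i j =>
  if h : i ∈ S ∧ j ∈ S then A ⟨i, h.1⟩ ⟨j, h.2⟩ else 0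

theorem principal_extendZero (S : Set V) (A : Matrix S S ℂ) :
    principal S (extendZero S A) = A := by
  ext i j
  simp [extendZero]

theorem extendZero_mem_supportedOn (S : Set V) (A : Matrix S S ℂ) :
    extendZero S A ∈ supportedOn S :=
  fun _ _ h => dif_neg (by tauto)

theorem principal_mem_Theta_iff {E : V → V → Prop} {S : Set V} {A : Matrix V V ℂ}
    (hA : A ∈ supportedOn S) :
    principal S A ∈ Theta (fun a b : S => E a.1 b.1) ↔ A ∈ Theta E := by
  constructor
  · intro h i j hij hE
    by_cases hS : i ∈ S ∧ j ∈ S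
    · exact h ⟨i, hS.1⟩ ⟨j, hS.2⟩ (fun e => hij (congrArg Subtype.val e)) hE
    · exact hA i j (by tauto)
  · intro h i j hij hE
    exact h i j (fun e => hij (Subtype.ext e)) hE

theorem isFullAt_principal_iff [Fintype V] {E : V → V → Prop} {S : Set V} [Fintype S] {r : S}
    {A : Matrix V V ℂ} (hA : A ∈ supportedOn S) :
    IsFullAt (fun a b : S => E a.1 b.1) Set.univ r (principal S A)
      ↔ IsFullAt E S r A := by
  have key : ∀ X ∈ supportedOn S,
      (principal S A * principal S X - principal S X * principal S A
        ∈ Theta (fun a b : S => E a.1 b.1)) ↔ A * X - X * A ∈ Theta E := by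
    intro X hX
    rw [← principal_mul hA, ← principal_mul hX,
      ← principal_mem_Theta_iff
        ((supportedOn S).sub_mem (mul_mem_supportedOn hA hX) (mul_mem_supportedOn hX hA))]
    rfl
  constructor
  · intro h X hX hC
    have hXS := hollowOn_le_supportedOn S _ hX
    have h0 := h (principal S X) (fun i j hij => hX i j (by
      simp only [Set.mem_univ, not_true, or_false] at hij
      rcases hij with h | h | h <;> simp [h])) ((key X hXS).2 hC)
    ext i j
    by_cases hS : i ∈ S ∧ j ∈ S
    · exact congrFun (congrFun h0 ⟨i, hS.1⟩) ⟨j, hS.2⟩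
    · exact hXS i j (by tauto)
  · intro h X hX hC
    have h0 := h (extendZero S X) (fun i j hij => by
      by_cases hS : i ∈ S ∧ j ∈ S
      · simp only [extendZero, hS, and_self, dif_pos]
        refine hX _ _ ?_
        rcases hij with h | h | h | h | h
        · exact Or.inl (Subtype.ext h)
        · exact Or.inr (Or.inl (Subtype.ext h))
        · exact Or.inr (Or.inr (Or.inl (Subtype.ext h)))
        · exact absurd hS.1 h
        · exact absurd hS.2 h
      · exact dif_neg hS)
      ((key _ (extendZero_mem_supportedOn S X)).1 (by rwa [principal_extendZero]))
    rw [← principal_extendZero S X, h0]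
    rfl

theorem hasFullB_induced_iff [Fintype V] (E : V → V → Prop) (S : Set V) [Fintype S] (r : S) :
    HasFullB (fun a b : S => E a.1 b.1) r
      ↔ ∃ A ∈ thetaSubmodule E ⊓ supportedOn S, IsFullAt E S r A := by
  rw [hasFullB_iff]
  constructor
  · rintro ⟨A, hA, hf⟩
    rw [← principal_extendZero S A] at hA hf
    have hS := extendZero_mem_supportedOn S A
    exact ⟨_, ⟨(principal_mem_Theta_iff hS).1 hA, hS⟩, (isFullAt_principal_iff hS).1 hf⟩
  · rintro ⟨A, ⟨hA, hS⟩, hf⟩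
    exact ⟨_, (principal_mem_Theta_iff hS).2 hA, (isFullAt_principal_iff hS).2 hf⟩

theorem cofiniteOnLines_isFullAt [Fintype V] (E : V → V → Prop) (S : Set V) (r : V) :
    CofiniteOnLines (IsFullAt E S r) := by
  intro A B hA
  have h := finite_not_injOn_line (hollowOn S r) (thetaSubmodule E)
    (LinearMap.mulLeft ℂ A - LinearMap.mulRight ℂ A)
    (LinearMap.mulLeft ℂ B - LinearMap.mulRight ℂ B) hA
  refine h.subset fun t ht ht' => ht fun X hX hC => ht' X hX ?_
  rw [← mem_thetaSubmodule] at hC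
  convert hC using 1
  simp only [LinearMap.sub_apply, LinearMap.mulLeft_apply, LinearMap.mulRight_apply, add_mul,
    mul_add, smul_mul_assoc, mul_smul_comm, smul_sub]
  abel

/-- A vector supported on `S` that vanishes at `r` is determined by the entries of `A x` at the
vertices of `S` other than `v`. -/
def MinorInjective [Fintype V] (S : Set V) (r v : V) (A : Matrix V V ℂ) : Prop :=
  ∀ x : V → ℂ, (∀ i, i = r ∨ i ∉ S → x i = 0) → (∀ k ∈ S, k ≠ v → (A *ᵥ x) k = 0) → x = 0

theorem cofiniteOnLines_minorInjective [Fintype V] (S : Set V) (r v : V) :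
    CofiniteOnLines (MinorInjective S r v) := by
  intro A B hA
  let p : Submodule ℂ (V → ℂ) :=
    { carrier := {x | ∀ i, i = r ∨ i ∉ S → x i = 0}
      add_mem' := fun {x y} hx hy i h => by simp [hx i h, hy i h]
      zero_mem' := fun _ _ => rfl
      smul_mem' := fun c x hx i h => by simp [hx i h] }
  let q : Submodule ℂ (V → ℂ) :=
    { carrier := {x | ∀ k ∈ S, k ≠ v → x k = 0}
      add_mem' := fun {x y} hx hy i h h' => by simp [hx i h h', hy i h h']
      zero_mem' := fun _ _ _ => rfl
      smul_mem' := fun c x hx i h h' => by simp [hx i h h'] }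
  have h := finite_not_injOn_line p q A.mulVecLin B.mulVecLin hA
  refine h.subset fun t ht ht' => ht fun x hx hC => ht' x hx ?_
  simp only [Matrix.add_mulVec, Matrix.smul_mulVec] at hC
  exact hC

/-- `k` is reachable from `v` by a walk of length `m`. -/
def ReachableIn (E : V → V → Prop) (v : V) : ℕ → V → Prop
  | 0, k => k = v
  | m + 1, k => ∃ i, ReachableIn E v m i ∧ E i k

theorem exists_reachableIn {E : V → V → Prop} {v k : V} (h : Relation.ReflTransGen E v k) :
    ∃ m, ReachableIn E v m k := by
  induction h with
  | refl => exact ⟨0, rfl⟩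
  | tail _ e ih =>
    obtain ⟨m, hm⟩ := ih
    exact ⟨m + 1, _, hm, e⟩

/-- A breadth-first spanning tree. -/
theorem exists_parent {E : V → V → Prop} {S : Set V} {v : V}
    (h : ∀ k ∈ S, Relation.ReflTransGen (fun a b => E a b ∧ a ∈ S ∧ b ∈ S) v k) :
    ∃ (par : V → V) (d : V → ℕ), ∀ k ∈ S, k ≠ v →
      E (par k) k ∧ par k ∈ S ∧ d (par k) < d k := by
  let E' : V → V → Prop := fun a b => E a b ∧ a ∈ S ∧ b ∈ S
  let d : V → ℕ := fun k => sInf {m | ReachableIn E' v m k}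
  have hpar : ∀ k, ∃ i, k ∈ S → k ≠ v → E i k ∧ i ∈ S ∧ d i < d k := by
    intro k
    by_cases hk : k ∈ S ∧ k ≠ v
    · have hd : ReachableIn E' v (d k) k :=
        Nat.sInf_mem (s := {m | ReachableIn E' v m k}) (exists_reachableIn (h k hk.1))
      cases hdk : d k with
      | zero =>
        rw [hdk] at hd
        exact absurd hd hk.2
      | succ m =>
        rw [hdk] at hd
        obtain ⟨i, hi, hE⟩ := hd
        exact ⟨i, fun _ _ => ⟨hE.1, hE.2.1,
          Nat.lt_succ_of_le (Nat.sInf_le (s := {m | ReachableIn E' v m i}) hi)⟩⟩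
    · exact ⟨k, fun h1 h2 => absurd ⟨h1, h2⟩ hk⟩
  choose par hpar using hpar
  exact ⟨par, d, hpar⟩

theorem exists_minorInjective [Fintype V] {E : V → V → Prop} {S : Set V}
    {r v : V} (hr : r ∈ S)
    (h : ∀ k ∈ S, Relation.ReflTransGen (fun a b => E a b ∧ a ∈ S ∧ b ∈ S) v k) :
    ∃ A ∈ thetaSubmodule E ⊓ supportedOn S, MinorInjective S r v A := by
  obtain ⟨par, d, hpar⟩ := exists_parent h
  refine ⟨fun k j => if k ∈ S ∧ k ≠ v then
    (if k = j then 1 else 0) - (if par k = j then 1 else 0) else 0, ⟨?_, ?_⟩, ?_⟩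
  · intro k j hkj hE
    by_cases hk : k ∈ S ∧ k ≠ v
    · have : par k ≠ j := by
        rintro rfl
        exact hE (hpar k hk.1 hk.2).1
      simp [hkj, this]
    · simp [hk]
  · intro k j hkj
    by_cases hk : k ∈ S ∧ k ≠ v
    · have h1 : k ≠ j := by
        rintro rfl
        tauto
      have h2 : par k ≠ j := by
        rintro rfl
        have := (hpar k hk.1 hk.2).2.1
        tauto
      simp [h1, h2]
    · simp [hk]
  · intro x hx hA
    have hstep : ∀ k ∈ S, k ≠ v → x k = x (par k) := by
      intro k hk hkv
      have := hA k hk hkv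
      simpa [Matrix.mulVec, dotProduct, hk, hkv, sub_mul, Finset.sum_sub_distrib,
        sub_eq_zero] using this
    have hconst : ∀ m, ∀ k ∈ S, d k = m → x k = x v := by
      intro m
      induction m using Nat.strong_induction_on with
      | _ m ih =>
        intro k hk hd
        by_cases hkv : k = v
        · rw [hkv]
        · obtain ⟨_, h2, h3⟩ := hpar k hk hkv
          rw [hstep k hk hkv]
          exact ih _ (hd ▸ h3) _ h2 rfl
    have hv : x v = 0 := by rw [← hconst _ r hr rfl, hx r (Or.inl rfl)]
    ext k
    by_cases hk : k ∈ S
    · rw [hconst _ k hk rfl, hv, Pi.zero_apply]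
    · exact hx k (Or.inr hk)

theorem exists_minorInjective_transpose [Fintype V] {E : V → V → Prop}
    {S : Set V} {r v : V} (hr : r ∈ S)
    (h : ∀ k ∈ S, Relation.ReflTransGen (fun a b => E a b ∧ a ∈ S ∧ b ∈ S) k v) :
    ∃ A ∈ thetaSubmodule E ⊓ supportedOn S, MinorInjective S r v Aᵀ := by
  obtain ⟨A, ⟨hA, hS⟩, hM⟩ := exists_minorInjective (E := Function.swap E) hr (v := v)
    (fun k hk => Relation.ReflTransGen.mono (fun a b hab => ⟨hab.1, hab.2.2, hab.2.1⟩) _ _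
      (Relation.reflTransGen_swap.2 (h k hk)))
  exact ⟨Aᵀ, ⟨fun i j hij hE => hA j i hij.symm hE, fun i j hij => hS j i hij.symm⟩,
    by rwa [Matrix.transpose_transpose]⟩

theorem cofiniteOnLines_minorInjective_transpose [Fintype V] (S : Set V) (r v : V) :
    CofiniteOnLines fun A : Matrix V V ℂ => MinorInjective S r v Aᵀ := by
  intro A B hA
  simpa using cofiniteOnLines_minorInjective S r v Aᵀ Bᵀ hA

/-- Two vertices of `S₁` joined by a walk are joined by one inside `S₁`, if every edge
lies in `S₁` or in a set meeting `S₁` in a single vertex. -/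
theorem reflTransGen_induced {E : V → V → Prop} {v : V} {S₁ S₂ : Set V}
    (hinter : S₁ ∩ S₂ = {v})
    (hedges : ∀ a b, E a b → (a ∈ S₁ ∧ b ∈ S₁) ∨ (a ∈ S₂ ∧ b ∈ S₂))
    {a b : V} (ha : a ∈ S₁) (hb : b ∈ S₁) (h : Relation.ReflTransGen E a b) :
    Relation.ReflTransGen (fun a b => E a b ∧ a ∈ S₁ ∧ b ∈ S₁) a b := by
  have hproj : ∀ c ∈ S₂, (if c ∈ S₁ then c else v) = v := by
    intro c hc
    split_ifs with h1
    · exact (hinter ▸ ⟨h1, hc⟩ : c ∈ ({v} : Set V))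
    · rfl
  have hlift : E ≤ Function.onFun
      (Relation.ReflTransGen fun a b => E a b ∧ a ∈ S₁ ∧ b ∈ S₁)
      (fun c => if c ∈ S₁ then c else v) := by
    intro c d hcd
    rcases hedges c d hcd with ⟨h1, h2⟩ | ⟨h1, h2⟩
    · simpa only [Function.onFun, h1, h2, if_true] using Relation.ReflTransGen.single ⟨hcd, h1, h2⟩
    · simp only [Function.onFun, hproj c h1, hproj d h2]
      exact Relation.ReflTransGen.refl
  have := Relation.ReflTransGen.lift' _ hlift _ _ h
  simpa [Function.onFun, ha, hb] using this

/-- The `S × T` block of a matrix, padded by zeros. -/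
noncomputable def block (S T : Set V) : Matrix V V ℂ →ₗ[ℂ] Matrix V V ℂ where
  toFun X := Matrix.of fun i j => if i ∈ S ∧ j ∈ T then X i j else 0
  map_add' X Y := by
    ext i j
    by_cases h : i ∈ S ∧ j ∈ T <;> simp [h]
  map_smul' c X := by
    ext i j
    by_cases h : i ∈ S ∧ j ∈ T <;> simp [h]

theorem block_apply (S T : Set V) (X : Matrix V V ℂ) (i j : V) :
    block S T X i j = if i ∈ S ∧ j ∈ T then X i j else 0 := rfl

theorem block_mem_supportedOn (S : Set V) (X : Matrix V V ℂ) : block S S X ∈ supportedOn S :=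
  fun _ _ h => if_neg (by tauto)

theorem mul_eq_zero_of_disjoint [Fintype V] {S T : Set V} (h : Disjoint S T) {A B : Matrix V V ℂ}
    (hA : A ∈ supportedOn S) (hB : B ∈ supportedOn T) : A * B = 0 := by
  ext i j
  rw [Matrix.mul_apply]
  refine Finset.sum_eq_zero fun k _ => ?_
  by_cases hk : k ∈ S
  · rw [hB k j (Or.inl (Set.disjoint_left.1 h hk)), mul_zero]
  · rw [hA i k (Or.inr hk), zero_mul]

/-- The commutator with `A`, as a linear map. -/
def commutatorMap [Fintype V] (A : Matrix V V ℂ) : Matrix V V ℂ →ₗ[ℂ] Matrix V V ℂ :=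
  LinearMap.mulLeft ℂ A - LinearMap.mulRight ℂ A

theorem commutatorMap_apply [Fintype V] (A X : Matrix V V ℂ) : commutatorMap A X = A * X - X * A :=
  rfl

/-- The part of a matrix that is block diagonal for the partition `S ∪ Sᶜ`. -/
noncomputable def diagBlocks (S : Set V) : Matrix V V ℂ →ₗ[ℂ] Matrix V V ℂ :=
  block S S + block Sᶜ Sᶜ

theorem diagBlocks_apply (S : Set V) (X : Matrix V V ℂ) (i j : V) :
    diagBlocks S X i j = if i ∈ S ↔ j ∈ S then X i j else 0 := by
  by_cases hi : i ∈ S <;> by_cases hj : j ∈ S <;> simp [diagBlocks, block_apply, hi, hj]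

/-- The part of a matrix that is block off-diagonal for the partition `S ∪ Sᶜ`. -/
noncomputable def offDiagBlocks (S : Set V) : Matrix V V ℂ →ₗ[ℂ] Matrix V V ℂ :=
  LinearMap.id - diagBlocks S

theorem offDiagBlocks_apply (S : Set V) (X : Matrix V V ℂ) (i j : V) :
    offDiagBlocks S X i j = if i ∈ S ↔ j ∈ S then 0 else X i j := by
  by_cases h : i ∈ S ↔ j ∈ S <;> simp [offDiagBlocks, diagBlocks_apply, h]

/-- For `A` supported on `S × S`, the commutator with `A` of the block diagonal part of a
matrix only sees its `S × S` block. -/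
theorem commutatorMap_diagBlocks [Fintype V] {S : Set V} {A : Matrix V V ℂ}
    (hA : A ∈ supportedOn S) (X : Matrix V V ℂ) :
    commutatorMap A (diagBlocks S X) = commutatorMap A (block S S X) := by
  have h := block_mem_supportedOn Sᶜ X
  simp only [commutatorMap_apply, diagBlocks, LinearMap.add_apply, mul_add, add_mul,
    mul_eq_zero_of_disjoint disjoint_compl_right hA h,
    mul_eq_zero_of_disjoint disjoint_compl_left h hA, add_zero]

theorem commutatorMap_mem_supportedOn [Fintype V] {S : Set V} {A X : Matrix V V ℂ}
    (hA : A ∈ supportedOn S) (hX : X ∈ supportedOn S) : commutatorMap A X ∈ supportedOn S :=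
  (supportedOn S).sub_mem (mul_mem_supportedOn hA hX) (mul_mem_supportedOn hX hA)

/-- The degenerate system at `t = 0` of the family `A₁ + t A₂` is nonsingular. -/
theorem eq_zero_of_degenerate [Fintype V] {E : V → V → Prop} {S₁ S₂ : Set V} {r v : V}
    (hunion : S₁ ∪ S₂ = Set.univ) (hinter : S₁ ∩ S₂ = {v})
    (hedges : ∀ a b, E a b → (a ∈ S₁ ∧ b ∈ S₁) ∨ (a ∈ S₂ ∧ b ∈ S₂))
    {A₁ A₂ : Matrix V V ℂ} (hA₁ : A₁ ∈ supportedOn S₁) (hA₂ : A₂ ∈ supportedOn S₂)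
    (hf₁ : IsFullAt E S₁ r A₁) (hf₂ : IsFullAt E S₂ v A₂)
    (hm : MinorInjective S₁ r v A₁) (hm' : MinorInjective S₁ r v A₁ᵀ)
    {Y : Matrix V V ℂ} (hY : Y ∈ hollowOn Set.univ r)
    (h₁ : ∀ i j, i ≠ j → ¬ E j i → i ∈ S₁ ∧ j ∈ S₁ → commutatorMap A₁ (block S₁ S₁ Y) i j = 0)
    (h₂ : ∀ i j, i ≠ j → ¬ E j i → ¬ (i ∈ S₁ ∧ j ∈ S₁) →
      (commutatorMap A₁ (offDiagBlocks S₁ Y) + commutatorMap A₂ (diagBlocks S₁ Y)) i j = 0) :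
    Y = 0 := by
  have hS : ∀ i, i ∈ S₁ ∨ i ∈ S₂ := fun i => (hunion ▸ Set.mem_univ i : i ∈ S₁ ∪ S₂)
  have hv : ∀ i, i ∈ S₁ → i ∈ S₂ → i = v := fun i h h' =>
    (hinter ▸ ⟨h, h'⟩ : i ∈ ({v} : Set V))
  have hvS : v ∈ S₁ ∩ S₂ := hinter ▸ Set.mem_singleton v
  have hY₁ : ∀ i j, i ∈ S₁ → j ∈ S₁ → Y i j = 0 := by
    have h0 : block S₁ S₁ Y = 0 := by
      refine hf₁ _ (fun i j hij => ?_) fun i j hij hE => ?_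
      · rw [block_apply]
        split_ifs with h
        · exact hY i j (by simp only [Set.mem_univ, not_true, or_false]; tauto)
        · rfl
      · by_cases h : i ∈ S₁ ∧ j ∈ S₁
        · exact h₁ i j hij hE h
        · exact commutatorMap_mem_supportedOn hA₁ (block_mem_supportedOn _ _) i j (by tauto)
    intro i j hi hj
    have := congrFun (congrFun h0 i) j
    rwa [block_apply, if_pos ⟨hi, hj⟩] at this
  have hD : ∀ i j, i ∈ S₁ ∨ j ∈ S₁ → diagBlocks S₁ Y i j = 0 := by
    intro i j h
    rw [diagBlocks_apply]
    split_ifs with h'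
    · exact hY₁ i j (by tauto) (by tauto)
    · rfl
  have hout : ∀ i j, i ∈ S₁ → i ≠ v → j ∉ S₁ → i ≠ j ∧ ¬ E j i ∧ ¬ E i j ∧ i ∉ S₂ := by
    intro i j hi hiv hj
    have hi2 : i ∉ S₂ := fun h => hiv (hv i hi h)
    refine ⟨fun h => hj (h ▸ hi), fun h => ?_, fun h => ?_, hi2⟩ <;>
      rcases hedges _ _ h with h | h <;> tauto
  have hY₂ : ∀ i j, i ∈ S₁ → j ∉ S₁ → Y i j = 0 := by
    intro i j hi hj
    have h0 := hm (fun i => offDiagBlocks S₁ Y i j) (fun i hi => ?_) fun k hk hkv => ?_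
    · have := congrFun h0 i
      simpa [offDiagBlocks_apply, hi, hj] using this
    · rw [offDiagBlocks_apply]
      split_ifs with h
      · rfl
      · rcases hi with hi | hi
        · exact hY i j (Or.inr (Or.inl hi))
        · tauto
    · obtain ⟨h3, h4, -, h5⟩ := hout k j hk hkv hj
      have h6 := h₂ k j h3 h4 (fun h => hj h.2)
      simp only [commutatorMap_apply, Matrix.add_apply, Matrix.sub_apply, Matrix.mul_apply] at h6
      simpa [hA₁ _ j (Or.inr hj), hA₂ k _ (Or.inl h5), hD k _ (Or.inl hk), Matrix.mulVec,
        dotProduct] using h6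
  have hY₃ : ∀ i j, i ∉ S₁ → j ∈ S₁ → Y i j = 0 := by
    intro j i hj hi
    have h0 := hm' (fun i => offDiagBlocks S₁ Y j i) (fun i hi => ?_) fun k hk hkv => ?_
    · have := congrFun h0 i
      simpa [offDiagBlocks_apply, hi, hj] using this
    · rw [offDiagBlocks_apply]
      split_ifs with h
      · rfl
      · rcases hi with hi | hi
        · exact hY j i (Or.inr (Or.inr (Or.inl hi)))
        · tauto
    · obtain ⟨h3, -, h4, h5⟩ := hout k j hk hkv hj
      have h6 := h₂ j k h3.symm h4 (fun h => hj h.1)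
      simp only [commutatorMap_apply, Matrix.add_apply, Matrix.sub_apply, Matrix.mul_apply] at h6
      simpa [hA₁ j _ (Or.inl hj), hA₂ _ k (Or.inr h5), hD _ k (Or.inr hk), Matrix.mulVec,
        dotProduct, mul_comm] using h6
  have hoff : offDiagBlocks S₁ Y = 0 := by
    ext i j
    rw [offDiagBlocks_apply]
    split_ifs with h
    · rfl
    · by_cases hi : i ∈ S₁
      · exact hY₂ i j hi (by tauto)
      · exact hY₃ i j hi (by tauto)
  have hdiag : diagBlocks S₁ Y = Y :=
    (sub_eq_zero.1 (show Y - diagBlocks S₁ Y = 0 from hoff)).symm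
  rw [hoff, hdiag, map_zero, zero_add] at h₂
  rw [hdiag] at hD
  have hYh : Y ∈ hollowOn S₂ v := by
    intro i j hij
    rcases hij with h | h | h | h | h
    · exact hY i j (Or.inl h)
    · exact hD i j (Or.inl (h ▸ hvS.1))
    · exact hD i j (Or.inr (h ▸ hvS.1))
    · exact hD i j (Or.inl ((hS i).resolve_right h))
    · exact hD i j (Or.inr ((hS j).resolve_right h))
  refine hf₂ Y hYh fun i j hij hE => ?_
  by_cases h : i ∈ S₁ ∧ j ∈ S₁
  · refine commutatorMap_mem_supportedOn hA₂ (hollowOn_le_supportedOn _ _ hYh) i j ?_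
    by_contra! h'
    exact hij ((hv i h.1 h'.1).trans (hv j h.2 h'.2).symm)
  · exact h₂ i j hij hE h

theorem exists_isFullAt_union [Fintype V] {E : V → V → Prop} {S₁ S₂ : Set V} {r v : V}
    (hunion : S₁ ∪ S₂ = Set.univ) (hinter : S₁ ∩ S₂ = {v})
    (hedges : ∀ a b, E a b → (a ∈ S₁ ∧ b ∈ S₁) ∨ (a ∈ S₂ ∧ b ∈ S₂))
    {A₁ A₂ : Matrix V V ℂ} (hA₁ : A₁ ∈ thetaSubmodule E ⊓ supportedOn S₁)
    (hA₂ : A₂ ∈ thetaSubmodule E ⊓ supportedOn S₂)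
    (hf₁ : IsFullAt E S₁ r A₁) (hf₂ : IsFullAt E S₂ v A₂)
    (hm : MinorInjective S₁ r v A₁) (hm' : MinorInjective S₁ r v A₁ᵀ) :
    ∃ A ∈ Theta E, IsFullAt E Set.univ r A := by
  let T₀ := commutatorMap A₁ ∘ₗ block S₁ S₁
  let T₁ := commutatorMap A₁ ∘ₗ offDiagBlocks S₁ + commutatorMap A₂ ∘ₗ diagBlocks S₁
  let T₂ := commutatorMap A₂ ∘ₗ offDiagBlocks S₁
  let π := block S₁ S₁
  have hπ : ∀ X Z : Matrix V V ℂ, ∀ i j,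
      (π X + (Z - π Z)) i j = if i ∈ S₁ ∧ j ∈ S₁ then X i j else Z i j := by
    intro X Z i j
    by_cases h : i ∈ S₁ ∧ j ∈ S₁ <;> simp [π, block_apply, h]
  have hfin := finite_not_injOn_pencil (hollowOn Set.univ r) (thetaSubmodule E)
    (π ∘ₗ T₀ + (T₁ - π ∘ₗ T₁)) (π ∘ₗ T₁ + (T₂ - π ∘ₗ T₂)) (π ∘ₗ T₂) fun Y hY hT => by
      refine eq_zero_of_degenerate hunion hinter hedges hA₁.2 hA₂.2 hf₁ hf₂ hm hm' hY
        (fun i j hij hE h => ?_) (fun i j hij hE h => ?_)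
      · exact (if_pos h).symm.trans ((hπ (T₀ Y) (T₁ Y) i j).symm.trans (hT i j hij hE))
      · exact (if_neg h).symm.trans ((hπ (T₀ Y) (T₁ Y) i j).symm.trans (hT i j hij hE))
  obtain ⟨t, ht⟩ := (hfin.union (Set.finite_singleton 0)).infinite_compl.nonempty
  simp only [Set.mem_compl_iff, Set.mem_union, not_or, Set.mem_singleton_iff] at ht
  obtain ⟨ht, ht0⟩ := ht
  replace ht := not_not.1 ht
  refine ⟨A₁ + t • A₂, (thetaSubmodule E).add_mem hA₁.1 ((thetaSubmodule E).smul_mem t hA₂.1),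
    fun X hX hC => ?_⟩
  let Y : Matrix V V ℂ := fun i j => if i ∈ S₁ ↔ j ∈ S₁ then X i j else t⁻¹ * X i j
  have hYX : diagBlocks S₁ Y + t • offDiagBlocks S₁ Y = X := by
    ext i j
    simp only [Matrix.add_apply, Matrix.smul_apply, smul_eq_mul, diagBlocks_apply,
      offDiagBlocks_apply]
    by_cases h : i ∈ S₁ ↔ j ∈ S₁ <;> simp [Y, h, ht0]
  have hsum : T₀ Y + t • T₁ Y + t ^ 2 • T₂ Y
      = (A₁ + t • A₂) * X - X * (A₁ + t • A₂) := by
    have h0 : T₀ Y = commutatorMap A₁ (diagBlocks S₁ Y) := (commutatorMap_diagBlocks hA₁.2 Y).symm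
    rw [h0, ← hYX]
    simp only [T₁, T₂, LinearMap.add_apply, LinearMap.comp_apply, commutatorMap_apply, add_mul,
      mul_add, smul_mul_assoc, mul_smul_comm, smul_sub, smul_add, smul_smul, pow_two]
    abel
  have hY0 : Y = 0 := by
    refine ht Y (fun i j hij => ?_) fun i j hij hE => ?_
    · simp only [Y, hX i j hij, mul_zero, ite_self]
    · have hij0 := hC i j hij hE
      rw [← hsum] at hij0
      simp only [LinearMap.add_apply, LinearMap.sub_apply, LinearMap.comp_apply,
        Matrix.add_apply, Matrix.sub_apply, Matrix.smul_apply, smul_eq_mul, π,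
        block_apply] at hij0 ⊢
      by_cases h : i ∈ S₁ ∧ j ∈ S₁
      · simpa [h] using hij0
      · have h0 : T₀ Y i j = 0 :=
          commutatorMap_mem_supportedOn hA₁.2 (block_mem_supportedOn _ _) i j (by tauto)
        have h1 : t * (T₁ Y i j + t * T₂ Y i j) = 0 := by
          rw [h0] at hij0
          linear_combination hij0
        simpa [h, ht0] using h1
  rw [← hYX, hY0]
  simp

theorem IsFullAt.restrict [Fintype V] {E : V → V → Prop} {S₁ S₂ : Set V} {r v : V}
    (hinter : S₁ ∩ S₂ = {v}) (hr : r ∈ S₁)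
    (hedges : ∀ a b, E a b → (a ∈ S₁ ∧ b ∈ S₁) ∨ (a ∈ S₂ ∧ b ∈ S₂))
    {A : Matrix V V ℂ} (hA : A ∈ Theta E) (hf : IsFullAt E Set.univ r A) :
    IsFullAt E S₂ v (block S₂ S₂ A) := by
  have hout : ∀ i k, i ∉ S₂ → k ∈ S₂ → k ≠ v → A i k = 0 ∧ A k i = 0 := by
    intro i k hi hk hkv
    have hk1 : k ∉ S₁ := fun h => hkv (hinter ▸ ⟨h, hk⟩ : k ∈ ({v} : Set V))
    have hik : i ≠ k := fun h => hi (h ▸ hk)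
    refine ⟨hA i k hik fun h => ?_, hA k i hik.symm fun h => ?_⟩ <;>
      rcases hedges _ _ h with h | h <;> tauto
  intro X hX hC
  have hl : block S₂ S₂ A * X = A * X := by
    ext i j
    simp only [Matrix.mul_apply, block_apply]
    refine Finset.sum_congr rfl fun k _ => ?_
    by_cases hk : k ∉ S₂ ∨ k = v
    · rw [hX k j (by tauto), mul_zero, mul_zero]
    · push Not at hk
      by_cases hi : i ∈ S₂
      · rw [if_pos ⟨hi, hk.1⟩]
      · rw [if_neg (fun h => hi h.1), (hout i k hi hk.1 hk.2).1]
  have hr' : X * block S₂ S₂ A = X * A := by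
    ext i j
    simp only [Matrix.mul_apply, block_apply]
    refine Finset.sum_congr rfl fun k _ => ?_
    by_cases hk : k ∉ S₂ ∨ k = v
    · rw [hX i k (by tauto), zero_mul, zero_mul]
    · push Not at hk
      by_cases hj : j ∈ S₂
      · rw [if_pos ⟨hk.1, hj⟩]
      · rw [if_neg (fun h => hj h.2), (hout j k hj hk.1 hk.2).2]
  rw [hl, hr'] at hC
  have hrv : r ∈ S₂ → r = v := fun h => (hinter ▸ ⟨hr, h⟩ : r ∈ ({v} : Set V))
  refine hf X (fun i j hij => hX i j ?_) hC
  simp only [Set.mem_univ, not_true, or_false] at hij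
  rcases hij with rfl | rfl | rfl
  · exact Or.inl rfl
  · tauto
  · tauto

/-- **graph union.** Let `G` be strongly connected on `Fin n`
with distinguished vertex `0`, written as the union of two induced subgraphs
`G₁` (on `S₁ ∋ 0`) and `G₂` (on `S₂`) meeting in the single vertex `v`, with
every edge inside `S₁` or inside `S₂`. Give `G₁` the distinguished vertex `0`
and `G₂` the distinguished vertex `v`. Then (1) if both `G₁` and `G₂` admit a
parameter matrix with `B` of full column rank, so does `G`; and (2) if `G₂`
admits none, neither does `G`. -/
theorem graph_union_fullB (n : ℕ) (hn : 2 ≤ n)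
    (E : Fin n → Fin n → Prop) (hirr : ∀ u, ¬ E u u)
    (hsc : ∀ u w : Fin n, Relation.ReflTransGen E u w)
    (v : Fin n) (S₁ S₂ : Set (Fin n))
    (hunion : S₁ ∪ S₂ = Set.univ) (hinter : S₁ ∩ S₂ = {v})
    (h0 : (⟨0, by omega⟩ : Fin n) ∈ S₁) (hv1 : v ∈ S₁) (hv2 : v ∈ S₂)
    (hedges : ∀ a b, E a b → (a ∈ S₁ ∧ b ∈ S₁) ∨ (a ∈ S₂ ∧ b ∈ S₂)) :
    ((HasFullB (fun a b : S₁ => E a.1 b.1) ⟨⟨0, by omega⟩, h0⟩ ∧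
        HasFullB (fun a b : S₂ => E a.1 b.1) ⟨v, hv2⟩) →
      HasFullB E ⟨0, by omega⟩) ∧
    (¬ HasFullB (fun a b : S₂ => E a.1 b.1) ⟨v, hv2⟩ →
      ¬ HasFullB E ⟨0, by omega⟩) := by
  constructor
  · rintro ⟨hG₁, hG₂⟩
    obtain ⟨A₂, hA₂, hf₂⟩ := (hasFullB_induced_iff E S₂ ⟨v, hv2⟩).1 hG₂
    have hpath : ∀ a ∈ S₁, ∀ b ∈ S₁,
        Relation.ReflTransGen (fun a b => E a b ∧ a ∈ S₁ ∧ b ∈ S₁) a b :=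
      fun a ha b hb => reflTransGen_induced hinter hedges ha hb (hsc a b)
    obtain ⟨A₁, hA₁, hf₁, hm, hm'⟩ :=
      (cofiniteOnLines_isFullAt E S₁ _).exists_and
        ((cofiniteOnLines_minorInjective S₁ _ v).and
          (cofiniteOnLines_minorInjective_transpose S₁ _ v))
        (thetaSubmodule E ⊓ supportedOn S₁)
        ((hasFullB_induced_iff E S₁ ⟨_, h0⟩).1 hG₁)
        ((cofiniteOnLines_minorInjective S₁ _ v).exists_and
          (cofiniteOnLines_minorInjective_transpose S₁ _ v) _
          (exists_minorInjective h0 (hpath v hv1))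
          (exists_minorInjective_transpose h0 fun k hk => hpath k hk v hv1))
    exact (hasFullB_iff E _).2
      (exists_isFullAt_union hunion hinter hedges hA₁ hA₂ hf₁ hf₂ hm hm')
  · intro hG₂ hG
    obtain ⟨A, hA, hf⟩ := (hasFullB_iff E _).1 hG
    refine hG₂ ((hasFullB_induced_iff E S₂ ⟨v, hv2⟩).2
      ⟨block S₂ S₂ A, ⟨fun i j hij hE => ?_, block_mem_supportedOn _ _⟩,
        hf.restrict hinter h0 hedges hA⟩)
    rw [block_apply, hA i j hij hE, ite_self]
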